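/- Let N < −1, let −∞ ≤ a < 0 < b ≤ ∞, and let w : (a,b) → (0,∞) be a continuous integrable function such that x ↦ w(x)^{1/(N-1)} is convex on (a,b), ∫_a^b w(x) dx = 1, and ∫_a^b x·w(x) dx = 0. Define R : ℝ → [0,1] by R(x) := ∫_a^{min(x,b)} w(s) ds for a < x and extended by 0 below a and 1 above b, set c := w(0)/R(0), and define F : ℝ → [0,1] by F(x) := (N/(N+1))^N·(1 + (c/N)·x)^N for x ≤ 1/c and F(x) := 1 for x > 1/c. If R(0) ≤ (1+ε)·(N/(N+1))^N for some ε > 0, then ∫_ℝ |R(x) − F(x)| dx ≤ (2N/w(0))·(N/(N+1))^N·(1+ε)·(1 − (1+ε)^{−1/N}). -/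

import Mathlib

open MeasureTheory

/-- The set of real numbers lying strictly between two extended real numbers. -/
def erealIoo (a b : EReal) : Set ℝ := {x : ℝ | a < (x : EReal) ∧ (x : EReal) < b}

/-- The powers `(1 - θ t) ^ (s - 1)` with `s < 0` are integrable near `-∞`. -/
lemma integrableOn_Iic_one_sub_mul_rpow {s θ x : ℝ} (hs : s < 0) (hθ : 0 < θ)
    (hx : θ * x < 1) :
    IntegrableOn (fun t : ℝ => (1 - θ * t) ^ (s - 1)) (Set.Iic x) := by
  have hpos : 0 < (1 - θ * x) / 2 := by linarith
  have h := (integrableOn_Ioi_rpow_of_lt (a := s - 1) (by linarith) hpos).integrable_indicator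
    measurableSet_Ioi
  have h' := (h.comp_sub_left 1).comp_mul_left' hθ.ne'
  refine h'.integrableOn.congr_fun (fun t ht => ?_) measurableSet_Iic
  have ht' : θ * t ≤ θ * x := mul_le_mul_of_nonneg_left ht hθ.le
  exact Set.indicator_of_mem (by simp only [Set.mem_Ioi]; linarith) _

/-- The integral of a power `(1 - θ t) ^ (s - 1)` with `s < 0` over a left half-line. -/
lemma integral_Iic_one_sub_mul_rpow {s θ x : ℝ} (hs : s < 0) (hθ : 0 < θ)
    (hx : θ * x < 1) :
    ∫ t in Set.Iic x, (1 - θ * t) ^ (s - 1) = (1 - θ * x) ^ s / (-s * θ) := by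
  have hlim : Filter.Tendsto (fun t : ℝ => (1 - θ * t) ^ s / (-s * θ)) Filter.atBot (nhds 0) := by
    have h1 : Filter.Tendsto (fun t : ℝ => 1 - θ * t) Filter.atBot Filter.atTop := by
      have : Filter.Tendsto (fun t : ℝ => (-θ) * t) Filter.atBot Filter.atTop :=
        Filter.tendsto_id.const_mul_atBot_of_neg (by linarith)
      refine (Filter.tendsto_atTop_add_const_left _ 1 this).congr fun t => by ring
    have h2 := (tendsto_rpow_neg_atTop (y := -s) (by linarith)).comp h1
    simpa [Function.comp_def] using h2.div_const (-s * θ)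
  have key := integral_Iic_of_hasDerivAt_of_tendsto' (a := x)
    (f := fun t : ℝ => (1 - θ * t) ^ s / (-s * θ)) (f' := fun t => (1 - θ * t) ^ (s - 1)) ?_
    (integrableOn_Iic_one_sub_mul_rpow hs hθ hx) hlim
  · simpa using key
  · intro t ht
    have ht' : θ * t ≤ θ * x := mul_le_mul_of_nonneg_left ht hθ.le
    have hd : HasDerivAt (fun t : ℝ => 1 - θ * t) (-θ) t := by
      simpa using ((hasDerivAt_id t).const_mul θ).const_sub 1
    refine ((hd.rpow_const (p := s) (Or.inl (by linarith))).div_const (-s * θ)).congr_deriv ?_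
    have hs0 : s ≠ 0 := hs.ne
    field_simp

/-- A layer-cake formula: the integral of the difference between the distribution function of `W`
and the unit step at the origin is minus the first moment. -/
lemma integrable_cdf_sub_step_and_integral {W : ℝ → ℝ} (hW : Integrable W)
    (hmass : ∫ s, W s = 1) (hxW : Integrable fun s => s * W s) :
    Integrable (fun x => (∫ s in Set.Iic x, W s) - (Set.Ioi (0 : ℝ)).indicator 1 x) ∧
      ∫ x, ((∫ s in Set.Iic x, W s) - (Set.Ioi (0 : ℝ)).indicator 1 x) = -∫ s, s * W s := by
  let k : ℝ → ℝ → ℝ := fun x s =>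
    (Set.Ici s).indicator (fun _ => 1) x - (Set.Ioi (0 : ℝ)).indicator (fun _ => 1) x
  have hk_neg : ∀ s, s ≤ 0 → (fun x => k x s) = (Set.Icc s 0).indicator fun _ => 1 := by
    intro s hs
    ext x
    simp only [k, Set.indicator_apply, Set.mem_Ici, Set.mem_Ioi, Set.mem_Icc]
    split_ifs <;> grind
  have hk_pos : ∀ s, 0 < s → (fun x => k x s) = (Set.Ioo 0 s).indicator fun _ => -1 := by
    intro s hs
    ext x
    simp only [k, Set.indicator_apply, Set.mem_Ici, Set.mem_Ioi, Set.mem_Ioo]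
    split_ifs <;> grind
  have hk_int : ∀ s, Integrable (fun x => k x s) := by
    intro s
    rcases le_or_gt s 0 with hs | hs
    · rw [hk_neg s hs]
      exact (integrable_indicator_iff measurableSet_Icc).2 (integrableOn_const (by simp))
    · rw [hk_pos s hs]
      exact (integrable_indicator_iff measurableSet_Ioo).2 (integrableOn_const (by simp))
  have hk_val : ∀ s, ∫ x, k x s = -s := by
    intro s
    rcases le_or_gt s 0 with hs | hs
    · rw [hk_neg s hs, integral_indicator measurableSet_Icc]
      simp [hs]
    · rw [hk_pos s hs, integral_indicator measurableSet_Ioo]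
      simp [hs.le]
  have hk_norm : ∀ s, ∫ x, ‖k x s‖ = |s| := by
    intro s
    rcases le_or_gt s 0 with hs | hs
    · have : ∀ x, ‖k x s‖ = (Set.Icc s 0).indicator (fun _ => 1) x := by
        intro x
        rw [congrFun (hk_neg s hs) x, norm_indicator_eq_indicator_norm]
        simp
      simp_rw [this]
      rw [integral_indicator measurableSet_Icc]
      simp [hs, abs_of_nonpos hs]
    · have : ∀ x, ‖k x s‖ = (Set.Ioo 0 s).indicator (fun _ => 1) x := by
        intro x
        rw [congrFun (hk_pos s hs) x, norm_indicator_eq_indicator_norm]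
        simp
      simp_rw [this]
      rw [integral_indicator measurableSet_Ioo]
      simp [hs.le, abs_of_pos hs]
  have hk_meas : Measurable (Function.uncurry k) := by
    refine Measurable.sub ?_ ?_
    · have : (fun p : ℝ × ℝ => (Set.Ici p.2).indicator (fun _ => (1 : ℝ)) p.1) =
          {p : ℝ × ℝ | p.2 ≤ p.1}.indicator fun _ => 1 := by
        ext p
        simp [Set.indicator_apply]
      rw [this]
      exact measurable_const.indicator (measurableSet_le measurable_snd measurable_fst)
    · exact (measurable_const.indicator measurableSet_Ioi).comp measurable_fst
  have hprod : Integrable (Function.uncurry fun x s => k x s * W s)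
      ((volume : Measure ℝ).prod volume) := by
    have hmeas : AEStronglyMeasurable (Function.uncurry fun x s => k x s * W s)
        ((volume : Measure ℝ).prod volume) :=
      hk_meas.aestronglyMeasurable.mul hW.aestronglyMeasurable.comp_snd
    rw [integrable_prod_iff' hmeas]
    refine ⟨Filter.Eventually.of_forall fun s => (hk_int s).mul_const (W s), ?_⟩
    refine hxW.norm.congr (Filter.Eventually.of_forall fun s => ?_)
    simp only [Function.uncurry, norm_mul, integral_mul_const, hk_norm, Real.norm_eq_abs s]
  have hrep : ∀ x, ∫ s, k x s * W s =
      (∫ s in Set.Iic x, W s) - (Set.Ioi (0 : ℝ)).indicator 1 x := by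
    intro x
    have : ∀ s, k x s * W s = (Set.Iic x).indicator W s -
        (Set.Ioi (0 : ℝ)).indicator (1 : ℝ → ℝ) x * W s := by
      intro s
      simp only [k, Set.indicator_apply, Set.mem_Ici, Set.mem_Ioi, Set.mem_Iic, Pi.one_apply]
      split_ifs <;> ring
    simp_rw [this]
    rw [integral_sub (hW.indicator measurableSet_Iic) (hW.const_mul _), integral_const_mul, hmass,
      integral_indicator measurableSet_Iic, mul_one]
  constructor
  · exact hprod.integral_prod_left.congr (Filter.Eventually.of_forall hrep)
  · simp_rw [← hrep]
    rw [integral_integral_swap hprod]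
    simp_rw [integral_mul_const, hk_val, neg_mul]
    exact integral_neg _

lemma mul_rpow_le_iff_of_neg {A B u p : ℝ} (hA : 0 < A) (hB : 0 < B) (hu : 0 < u) (hp : p < 0) :
    A * u ^ p ≤ B ↔ B ^ (1 / p) ≤ A ^ (1 / p) * u := by
  have h := Real.rpow_le_rpow_iff_of_neg hB (mul_pos hA (Real.rpow_pos_of_pos hu p))
    (one_div_neg.2 hp)
  rw [← h, Real.mul_rpow hA.le (Real.rpow_pos_of_pos hu p).le, ← Real.rpow_mul hu.le,
    mul_one_div_cancel hp.ne, Real.rpow_one]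

section Crossing

variable {S : Set ℝ} {w : ℝ → ℝ} {N θ : ℝ}

/-- A power `w ^ (1 / (N - 1))` that is convex stays convex after subtracting the same power of the
density `w 0 * (1 - θ x) ^ (N - 1)`, which is affine. -/
lemma convexOn_rpow_sub_affine (hconv : ConvexOn ℝ S fun x => w x ^ (1 / (N - 1))) :
    ConvexOn ℝ S fun x => w x ^ (1 / (N - 1)) - w 0 ^ (1 / (N - 1)) * (1 - θ * x) := by
  refine ⟨hconv.1, fun x hx y hy α β hα hβ hαβ => ?_⟩
  have h := hconv.2 hx hy hα hβ hαβ
  simp only [smul_eq_mul] at h ⊢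
  have : β = 1 - α := by linarith
  subst this
  linarith

/-- To the left of the origin, once `w` is below the power density, it stays below. -/
lemma indicator_lt_of_lt_of_le (hN : N < -1) (hw : ∀ x ∈ S, 0 < w x)
    (hconv : ConvexOn ℝ S fun x => w x ^ (1 / (N - 1))) (h0 : (0 : ℝ) ∈ S) (hθ : 0 < θ)
    {x y : ℝ} (hyx : y ≤ x) (hx0 : x ≤ 0)
    (hx : S.indicator w x < w 0 * (1 - θ * x) ^ (N - 1)) :
    S.indicator w y < w 0 * (1 - θ * y) ^ (N - 1) := by
  have hux : 0 < 1 - θ * x := by nlinarith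
  have huy : 0 < 1 - θ * y := by nlinarith
  by_cases hyS : y ∈ S
  swap
  · rw [Set.indicator_of_notMem hyS]
    exact mul_pos (hw 0 h0) (Real.rpow_pos_of_pos huy _)
  have hxS : x ∈ S := hconv.1.ordConnected.out hyS h0 ⟨hyx, hx0⟩
  rw [Set.indicator_of_mem hxS] at hx
  rw [Set.indicator_of_mem hyS]
  by_contra! hy
  rw [mul_rpow_le_iff_of_neg (hw 0 h0) (hw y hyS) huy (by linarith)] at hy
  rw [← not_le, mul_rpow_le_iff_of_neg (hw 0 h0) (hw x hxS) hux (by linarith)] at hx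
  refine hx ?_
  have hc := (convexOn_rpow_sub_affine (θ := θ) hconv).convex_le 0
  have := hc.ordConnected.out (x := y) ⟨hyS, by linarith⟩ (y := 0) ⟨h0, by simp⟩ ⟨hyx, hx0⟩
  linarith [this.2]

/-- If `w` exceeds the power density somewhere to the right of the origin, it lies below it
everywhere to the left of the origin. -/
lemma indicator_lt_of_lt_indicator (hN : N < -1) (hw : ∀ x ∈ S, 0 < w x)
    (hconv : ConvexOn ℝ S fun x => w x ^ (1 / (N - 1))) (h0 : (0 : ℝ) ∈ S) (hθ : 0 < θ)
    {x y : ℝ} (hx0 : x < 0) (hy0 : 0 < y) (hy1 : θ * y < 1)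
    (hy : w 0 * (1 - θ * y) ^ (N - 1) < S.indicator w y) :
    S.indicator w x < w 0 * (1 - θ * x) ^ (N - 1) := by
  have hux : 0 < 1 - θ * x := by nlinarith
  have huy : 0 < 1 - θ * y := by linarith
  have hm : 0 < w 0 * (1 - θ * y) ^ (N - 1) := mul_pos (hw 0 h0) (Real.rpow_pos_of_pos huy _)
  by_cases hyS : y ∈ S
  swap
  · rw [Set.indicator_of_notMem hyS] at hy
    exact absurd hm hy.not_gt
  rw [Set.indicator_of_mem hyS] at hy
  by_cases hxS : x ∈ S
  swap
  · rw [Set.indicator_of_notMem hxS]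
    exact mul_pos (hw 0 h0) (Real.rpow_pos_of_pos hux _)
  rw [Set.indicator_of_mem hxS]
  by_contra! hx
  rw [mul_rpow_le_iff_of_neg (hw 0 h0) (hw x hxS) hux (by linarith)] at hx
  have hy' : w y ^ (1 / (N - 1)) < w 0 ^ (1 / (N - 1)) * (1 - θ * y) := by
    refine lt_of_le_of_ne
      ((mul_rpow_le_iff_of_neg (hw 0 h0) (hw y hyS) huy (by linarith)).1 hy.le) fun heq => ?_
    have h1 : (w y ^ (1 / (N - 1))) ^ (N - 1) = w y := by
      rw [← Real.rpow_mul (hw y hyS).le, one_div_mul_cancel (by linarith), Real.rpow_one]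
    rw [heq, Real.mul_rpow (Real.rpow_pos_of_pos (hw 0 h0) _).le huy.le,
      ← Real.rpow_mul (hw 0 h0).le, one_div_mul_cancel (by linarith), Real.rpow_one] at h1
    exact hy.ne h1
  have hyx : 0 < y - x := by linarith
  have hα : 0 < y / (y - x) := div_pos hy0 hyx
  have hβ : 0 < -x / (y - x) := div_pos (by linarith) hyx
  have hαβ : y / (y - x) + -x / (y - x) = 1 := by
    rw [← add_div, ← sub_eq_add_neg, div_self hyx.ne']
  have hc := (convexOn_rpow_sub_affine (θ := θ) hconv).2 hxS hyS hα.le hβ.le hαβ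
  have hz : (y / (y - x)) • x + (-x / (y - x)) • y = 0 := by
    simp only [smul_eq_mul]
    ring
  rw [hz] at hc
  simp only [smul_eq_mul, mul_zero, sub_zero, mul_one, sub_self] at hc
  have h1 : y / (y - x) * (w x ^ (1 / (N - 1)) - w 0 ^ (1 / (N - 1)) * (1 - θ * x)) ≤ 0 :=
    mul_nonpos_of_nonneg_of_nonpos hα.le (by linarith)
  have h2 : -x / (y - x) * (w y ^ (1 / (N - 1)) - w 0 ^ (1 / (N - 1)) * (1 - θ * y)) < 0 :=
    mul_neg_of_pos_of_neg hβ (by linarith)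
  linarith

/-- The first moment of a density with `w ^ (1 / (N - 1))` convex converges at `-∞`. -/
lemma integrableOn_Iic_mul_indicator (hN : N < -1) (hw : ∀ x ∈ S, 0 < w x)
    (hconv : ConvexOn ℝ S fun x => w x ^ (1 / (N - 1))) (h0 : (0 : ℝ) ∈ S)
    (hW : Integrable (S.indicator w)) (hpos : 0 < ∫ x in Set.Iic 0, S.indicator w x) :
    IntegrableOn (fun x => x * S.indicator w x) (Set.Iic 0) := by
  have hnn : ∀ x, 0 ≤ S.indicator w x := Set.indicator_nonneg fun x hx => (hw x hx).le
  have hw0 := hw 0 h0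
  set r := ∫ x in Set.Iic 0, S.indicator w x with hr
  set θ := w 0 / (-N * (2 * r)) with hθdef
  have hθ : 0 < θ := div_pos hw0 (mul_pos (by linarith) (by linarith))
  have hmint : ∀ x ≤ 0, IntegrableOn (fun t : ℝ => w 0 * (1 - θ * t) ^ (N - 1)) (Set.Iic x) :=
    fun x hx => (integrableOn_Iic_one_sub_mul_rpow (by linarith) hθ (by nlinarith)).const_mul _
  have hmval : ∫ t in Set.Iic 0, w 0 * (1 - θ * t) ^ (N - 1) = 2 * r := by
    rw [integral_const_mul, integral_Iic_one_sub_mul_rpow (by linarith) hθ (by simp), hθdef]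
    have : N ≠ 0 := by linarith
    simp only [mul_zero, sub_zero, Real.one_rpow]
    field_simp
  obtain ⟨x₀, hx₀, hlt⟩ : ∃ x ≤ 0, S.indicator w x < w 0 * (1 - θ * x) ^ (N - 1) := by
    by_contra! h
    have := setIntegral_mono_on (hmint 0 le_rfl) hW.integrableOn measurableSet_Iic h
    rw [hmval] at this
    linarith
  have hmeas : AEStronglyMeasurable (fun x => x * S.indicator w x) volume :=
    aestronglyMeasurable_id.mul hW.aestronglyMeasurable
  have hfar : IntegrableOn (fun x => x * S.indicator w x) (Set.Iic x₀) := by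
    have hdom : IntegrableOn (fun t : ℝ => w 0 / θ * (1 - θ * t) ^ (N + 1 - 1)) (Set.Iic x₀) :=
      (integrableOn_Iic_one_sub_mul_rpow (by linarith) hθ (by nlinarith)).const_mul _
    refine Integrable.mono' hdom hmeas.restrict ?_
    filter_upwards [ae_restrict_mem measurableSet_Iic] with x hx
    have hx' : x ≤ 0 := le_trans hx hx₀
    have hu : 0 < 1 - θ * x := by nlinarith
    have hle := (indicator_lt_of_lt_of_le hN hw hconv h0 hθ hx hx₀ hlt).le
    rw [norm_mul, Real.norm_eq_abs, Real.norm_eq_abs, abs_of_nonneg (hnn x), abs_of_nonpos hx']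
    have hxu : -x ≤ (1 - θ * x) / θ := by
      rw [le_div_iff₀ hθ]
      linarith
    calc -x * S.indicator w x
        ≤ (1 - θ * x) / θ * (w 0 * (1 - θ * x) ^ (N - 1)) :=
          mul_le_mul hxu hle (hnn x) (by positivity)
      _ = w 0 / θ * (1 - θ * x) ^ (N + 1 - 1) := by
          have : (1 - θ * x) ^ (N + 1 - 1) = (1 - θ * x) ^ (N - 1) * (1 - θ * x) := by
            rw [← Real.rpow_add_one hu.ne']
            ring_nf
          rw [this]
          ring
  have hnear : IntegrableOn (fun x => x * S.indicator w x) (Set.Ioc x₀ 0) := by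
    refine Integrable.mono' (hW.integrableOn.const_mul (-x₀)) hmeas.restrict ?_
    filter_upwards [ae_restrict_mem measurableSet_Ioc] with x hx
    rw [norm_mul, Real.norm_eq_abs, Real.norm_eq_abs, abs_of_nonneg (hnn x), abs_of_nonpos hx.2]
    exact mul_le_mul_of_nonneg_right (by linarith [hx.1]) (hnn x)
  rw [← Set.Iic_union_Ioc_eq_Iic hx₀]
  exact hfar.union hnear

/-- The distribution function of `w` lies below the power function tangent to it at the origin. -/
lemma integral_Iic_indicator_le (hN : N < -1) (hw : ∀ x ∈ S, 0 < w x)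
    (hconv : ConvexOn ℝ S fun x => w x ^ (1 / (N - 1))) (h0 : (0 : ℝ) ∈ S)
    (hW : Integrable (S.indicator w)) {r : ℝ} (hr : r = ∫ x in Set.Iic 0, S.indicator w x)
    (hr0 : 0 < r) (hθdef : θ = w 0 / (-N * r)) {x : ℝ} (hx : θ * x < 1) :
    ∫ t in Set.Iic x, S.indicator w t ≤ r * (1 - θ * x) ^ N := by
  have hw0 := hw 0 h0
  have hN0 : 0 < -N := by linarith
  have hθ : 0 < θ := hθdef ▸ div_pos hw0 (mul_pos hN0 hr0)
  set m : ℝ → ℝ := fun t => w 0 * (1 - θ * t) ^ (N - 1) with hm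
  have hmint : ∀ y, θ * y < 1 → IntegrableOn m (Set.Iic y) := fun y hy =>
    (integrableOn_Iic_one_sub_mul_rpow (by linarith) hθ hy).const_mul _
  have hmval : ∀ y, θ * y < 1 → ∫ t in Set.Iic y, m t = r * (1 - θ * y) ^ N := by
    intro y hy
    rw [hm, integral_const_mul, integral_Iic_one_sub_mul_rpow (by linarith) hθ hy, hθdef]
    have : N ≠ 0 := by linarith
    field_simp
  have hm0 : ∫ t in Set.Iic 0, m t = r := by
    rw [hmval 0 (by simp)]
    simp
  rw [← hmval x hx]
  rcases le_or_gt x 0 with hx0 | hx0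
  · by_cases hlt : S.indicator w x < m x
    · exact setIntegral_mono_on hW.integrableOn (hmint x hx) measurableSet_Iic fun t ht =>
        (indicator_lt_of_lt_of_le hN hw hconv h0 hθ ht hx0 hlt).le
    · have h1 := intervalIntegral.integral_Iic_sub_Iic (hmint x hx) (hmint 0 (by simp))
      have h2 := intervalIntegral.integral_Iic_sub_Iic (a := x) (b := 0)
        hW.integrableOn hW.integrableOn
      have h3 : ∫ t in x..0, m t ≤ ∫ t in x..0, S.indicator w t := by
        rw [intervalIntegral.integral_of_le hx0, intervalIntegral.integral_of_le hx0]
        refine setIntegral_mono_on ((hmint 0 (by simp)).mono_set Set.Ioc_subset_Iic_self)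
          hW.integrableOn measurableSet_Ioc fun t ht => ?_
        by_contra! hlt'
        exact hlt (indicator_lt_of_lt_of_le hN hw hconv h0 hθ ht.1.le ht.2 hlt')
      linarith
  · have hle : ∀ y, 0 < y → θ * y < 1 → S.indicator w y ≤ m y := by
      intro y hy0 hy1
      by_contra! hlt
      have hneg : ∀ t ∈ Set.Iio (0 : ℝ), 0 < m t - S.indicator w t := fun t ht =>
        sub_pos.2 (indicator_lt_of_lt_indicator hN hw hconv h0 hθ ht hy0 hy1 hlt)
      have hint : IntegrableOn (fun t => m t - S.indicator w t) (Set.Iio 0) :=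
        ((hmint 0 (by simp)).mono_set Set.Iio_subset_Iic_self).sub hW.integrableOn
      have hpos : 0 < ∫ t in Set.Iio (0 : ℝ), (m t - S.indicator w t) := by
        rw [setIntegral_pos_iff_support_of_nonneg_ae _ hint]
        · have hsub : Set.Iio 0 ⊆ Function.support fun t => m t - S.indicator w t :=
            fun t ht => (hneg t ht).ne'
          rw [Set.inter_eq_right.2 hsub]
          simp
        · filter_upwards [ae_restrict_mem measurableSet_Iio] with t ht using (hneg t ht).le
      rw [← integral_Iic_eq_integral_Iio, integral_sub (hmint 0 (by simp)) hW.integrableOn, hm0,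
        ← hr] at hpos
      linarith
    have h1 := intervalIntegral.integral_Iic_sub_Iic (hmint 0 (by simp)) (hmint x hx)
    have h2 := intervalIntegral.integral_Iic_sub_Iic (a := 0) (b := x)
      hW.integrableOn hW.integrableOn
    have h3 : ∫ t in (0 : ℝ)..x, S.indicator w t ≤ ∫ t in (0 : ℝ)..x, m t := by
      rw [intervalIntegral.integral_of_le hx0.le, intervalIntegral.integral_of_le hx0.le]
      exact setIntegral_mono_on hW.integrableOn
        ((hmint x hx).mono_set Set.Ioc_subset_Iic_self) measurableSet_Ioc fun t ht =>
          hle t ht.1 (lt_of_le_of_lt (mul_le_mul_of_nonneg_left ht.2 hθ.le) hx)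
    linarith

end Crossing

/-- The first moment of a density with `w ^ (1 / (N - 1))` convex converges. -/
lemma integrable_mul_indicator {S : Set ℝ} {w : ℝ → ℝ} {N : ℝ} (hN : N < -1)
    (hw : ∀ x ∈ S, 0 < w x) (hconv : ConvexOn ℝ S fun x => w x ^ (1 / (N - 1)))
    (h0 : (0 : ℝ) ∈ S) (hW : Integrable (S.indicator w))
    (hleft : 0 < ∫ x in Set.Iic 0, S.indicator w x)
    (hright : 0 < ∫ x in Set.Ioi 0, S.indicator w x) :
    Integrable fun x => x * S.indicator w x := by
  have hrefl : ∀ x, {x | -x ∈ S}.indicator (fun x => w (-x)) x = S.indicator w (-x) := by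
    classical
    intro x
    simp only [Set.indicator_apply, Set.mem_ofPred_eq]
  have hconv' : ConvexOn ℝ {x | -x ∈ S} fun x => w (-x) ^ (1 / (N - 1)) :=
    hconv.comp_linearMap (-LinearMap.id)
  have h := integrableOn_Iic_mul_indicator (S := {x | -x ∈ S}) (w := fun x => w (-x)) hN
    (fun x hx => hw (-x) hx) hconv' (by simpa using h0)
    ((funext hrefl).symm ▸ hW.comp_neg)
    (by simp only [hrefl, integral_comp_neg_Iic, neg_zero, hright])
  have hR : IntegrableOn (fun x => x * S.indicator w x) (Set.Ici 0) := by
    refine ((h.integrable_indicator measurableSet_Iic).comp_neg.neg.integrableOn).congr_fun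
      (fun x hx => ?_) measurableSet_Ici
    have hx' : -x ∈ Set.Iic (0 : ℝ) := by simpa using hx
    simp [Set.indicator_of_mem hx', hrefl]
  rw [← integrableOn_univ, ← Set.Iic_union_Ici (a := (0 : ℝ))]
  exact (integrableOn_Iic_mul_indicator hN hw hconv h0 hW hleft).union hR

/-- The distribution function with value `r * (1 - θ x) ^ N` up to the point where this reaches
one, and one afterwards. -/
noncomputable def truncatedPowerCdf (N θ r x : ℝ) : ℝ :=
  if x ≤ (1 - r ^ (-1 / N)) / θ then r * (1 - θ * x) ^ N else 1

section TruncatedPowerCdf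

variable {N θ r : ℝ}

lemma mul_rpow_rpow_neg_one_div (hN : N < -1) (hr : 0 < r) : r * (r ^ (-1 / N)) ^ N = 1 := by
  rw [← Real.rpow_mul hr.le, div_mul_cancel₀ _ (by linarith), Real.rpow_neg_one,
    mul_inv_cancel₀ hr.ne']

lemma rpow_neg_one_div_mono (hN : N < -1) (hr : 0 < r) {r' : ℝ} (hrr' : r ≤ r') :
    r ^ (-1 / N) ≤ r' ^ (-1 / N) :=
  Real.rpow_le_rpow hr.le hrr' (div_nonneg_of_nonpos (by linarith) (by linarith))

lemma truncatedPowerCdf_mono (hN : N < -1) (hθ : 0 < θ) (hr : 0 < r) {r' : ℝ} (hrr' : r ≤ r')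
    (x : ℝ) : truncatedPowerCdf N θ r x ≤ truncatedPowerCdf N θ r' x := by
  have hu : 0 < r ^ (-1 / N) := Real.rpow_pos_of_pos hr _
  have hu' := rpow_neg_one_div_mono hN hr hrr'
  unfold truncatedPowerCdf
  simp only [le_div_iff₀ hθ]
  split_ifs with h1 h2
  · exact mul_le_mul_of_nonneg_right hrr' (Real.rpow_nonneg (by linarith) _)
  · exact (mul_le_mul_of_nonneg_left (Real.rpow_le_rpow_of_nonpos hu (by linarith) (by linarith))
      hr.le).trans_eq (mul_rpow_rpow_neg_one_div hN hr)
  · exact absurd h1 (by linarith)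
  · exact le_rfl

lemma integrable_truncatedPowerCdf_sub_step_and_integral (hN : N < -1) (hθ : 0 < θ) (hr : 0 < r)
    (hr1 : r ≤ 1) :
    Integrable (fun x => truncatedPowerCdf N θ r x - (Set.Ioi (0 : ℝ)).indicator 1 x) ∧
      ∫ x, (truncatedPowerCdf N θ r x - (Set.Ioi (0 : ℝ)).indicator 1 x) =
        (N / (N + 1) * r ^ (-1 / N) - 1) / θ := by
  set u := r ^ (-1 / N) with hu_def
  have hu : 0 < u := Real.rpow_pos_of_pos hr _
  have hu1 : u ≤ 1 := by simpa using rpow_neg_one_div_mono hN hr hr1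
  set τ := (1 - u) / θ with hτ
  have hτ0 : 0 ≤ τ := div_nonneg (by linarith) hθ.le
  have hθτ : θ * τ = 1 - u := mul_div_cancel₀ _ hθ.ne'
  have hrep : (fun x => truncatedPowerCdf N θ r x - (Set.Ioi (0 : ℝ)).indicator 1 x) =
      fun x => (Set.Iic τ).indicator (fun t => r * (1 - θ * t) ^ (N + 1 - 1)) x -
        (Set.Ioc 0 τ).indicator (fun _ => 1) x := by
    ext x
    simp only [truncatedPowerCdf, Set.indicator_apply, Set.mem_Iic, Set.mem_Ioi, Set.mem_Ioc,
      ← hu_def, ← hτ, add_sub_cancel_right, Pi.one_apply]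
    split_ifs <;> grind
  have hlt : θ * τ < 1 := by linarith
  have h1 : Integrable ((Set.Iic τ).indicator fun t => r * (1 - θ * t) ^ (N + 1 - 1)) :=
    (integrable_indicator_iff measurableSet_Iic).2
      ((integrableOn_Iic_one_sub_mul_rpow (by linarith) hθ hlt).const_mul r)
  have h2 : Integrable ((Set.Ioc 0 τ).indicator fun _ => (1 : ℝ)) :=
    (integrable_indicator_iff measurableSet_Ioc).2 (integrableOn_const (by simp))
  rw [hrep]
  refine ⟨h1.sub h2, ?_⟩
  have hpow : r * u ^ (N + 1) = u := by
    rw [Real.rpow_add_one hu.ne', ← mul_assoc, mul_rpow_rpow_neg_one_div hN hr, one_mul]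
  rw [integral_sub h1 h2, integral_indicator measurableSet_Iic,
    integral_indicator measurableSet_Ioc, integral_const_mul,
    integral_Iic_one_sub_mul_rpow (by linarith) hθ hlt, hθτ, sub_sub_cancel, ← mul_div_assoc, hpow]
  have hN1 : N + 1 ≠ 0 := by linarith
  rw [setIntegral_const, Real.volume_real_Ioc_of_le hτ0, smul_eq_mul, mul_one, sub_zero, hτ]
  field_simp
  ring

end TruncatedPowerCdf

/-- Stability of the one-dimensional Grünbaum inequality for `N < -1`: if the
bound is almost attained, the cumulative distribution function `R` of `w` is close
in `L¹(ℝ)` to the cumulative distribution function `F` of the rigidity model. -/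
theorem grunbaum_one_dim_neg_stability (N ε : ℝ) (a b : EReal) (w R F : ℝ → ℝ)
    (c : ℝ) (hN : N < -1) (ha : a < (0 : EReal)) (hb : (0 : EReal) < b)
    (hw : ∀ x ∈ erealIoo a b, 0 < w x)
    (hcont : ContinuousOn w (erealIoo a b))
    (hint : IntegrableOn w (erealIoo a b))
    (hconv : ConvexOn ℝ (erealIoo a b) (fun x => w x ^ (1 / (N - 1))))
    (hmass : ∫ x in erealIoo a b, w x = 1)
    (hbar : ∫ x in erealIoo a b, x * w x = 0)
    (hR : ∀ x : ℝ, R x = ∫ s in erealIoo a b ∩ Set.Iio x, w s)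
    (hc : c = w 0 / R 0)
    (hF : ∀ x : ℝ, F x =
      if x ≤ 1 / c then (N / (N + 1)) ^ N * (1 + (c / N) * x) ^ N else 1)
    (hε : 0 < ε)
    (hclose : R 0 ≤ (1 + ε) * (N / (N + 1)) ^ N) :
    (∫ x : ℝ, |R x - F x|) ≤
      2 * N / w 0 * (N / (N + 1)) ^ N * (1 + ε) * (1 - (1 + ε) ^ (-1 / N)) := by
  set S := erealIoo a b with hS
  have hSopen : IsOpen S := isOpen_Ioo.preimage continuous_coe_real_ereal
  have hSmeas := hSopen.measurableSet
  have h0 : (0 : ℝ) ∈ S := ⟨by simpa using ha, by simpa using hb⟩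
  have hw0 := hw 0 h0
  set W := S.indicator w with hWdef
  have hW : Integrable W := hint.integrable_indicator hSmeas
  have hWnn : ∀ x, 0 ≤ W x := Set.indicator_nonneg fun x hx => (hw x hx).le
  have hWmass : ∫ x, W x = 1 := by rw [hWdef, integral_indicator hSmeas, hmass]
  have hWbar : ∫ x, x * W x = 0 := by
    rw [← hbar, ← integral_indicator hSmeas]
    congr with x
    exact (Set.indicator_mul_right S (fun x => x) w).symm
  have hRW : ∀ x, R x = ∫ s in Set.Iic x, W s := by
    intro x
    rw [hR, integral_Iic_eq_integral_Iio, hWdef, setIntegral_indicator hSmeas, Set.inter_comm]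
  obtain ⟨δ, hδ, hball⟩ := Metric.isOpen_iff.1 hSopen 0 h0
  have hpos : ∀ T : Set ℝ, 0 < volume (Metric.ball 0 δ ∩ T) → 0 < ∫ x in T, W x := by
    intro T hT
    rw [setIntegral_pos_iff_support_of_nonneg_ae (Filter.Eventually.of_forall hWnn)
      hW.integrableOn]
    refine hT.trans_le (measure_mono (Set.inter_subset_inter_left _ fun x hx => ?_))
    rw [Function.mem_support, hWdef, Set.indicator_of_mem (hball hx)]
    exact (hw x (hball hx)).ne'
  rw [Real.ball_eq_Ioo] at hpos
  have hleft : 0 < ∫ x in Set.Iic 0, W x := by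
    refine hpos _ (lt_of_lt_of_le (?_ : 0 < volume (Set.Ioo (-δ) 0)) (measure_mono fun x hx => ?_))
    · simpa using hδ
    · exact ⟨⟨by linarith [hx.1], by linarith [hx.2]⟩, hx.2.le⟩
  have hright : 0 < ∫ x in Set.Ioi 0, W x := by
    refine hpos _ (lt_of_lt_of_le (?_ : 0 < volume (Set.Ioo 0 δ)) (measure_mono fun x hx => ?_))
    · simpa using hδ
    · exact ⟨⟨by linarith [hx.1], by linarith [hx.2]⟩, hx.1⟩
  have hxW := integrable_mul_indicator hN hw hconv h0 hW hleft hright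
  set r := R 0 with hr
  have hr0 : 0 < r := by rwa [hr, hRW]
  have hRle : ∀ x, R x ≤ 1 := by
    intro x
    rw [hRW, ← hWmass]
    exact setIntegral_le_integral hW (Filter.Eventually.of_forall hWnn)
  have hr1 : r ≤ 1 := hRle 0
  set θ := w 0 / (-N * r) with hθdef
  have hθ : 0 < θ := div_pos hw0 (mul_pos (by linarith) hr0)
  have hcN : c / N = -θ := by
    have : N ≠ 0 := by linarith
    rw [hc, hθdef]
    field_simp
  set q := N / (N + 1) with hq
  have hq1 : 1 < q := by
    rw [hq, one_lt_div_of_neg (by linarith)]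
    linarith
  set K := q ^ N with hK
  have hK0 : 0 < K := Real.rpow_pos_of_pos (by linarith) _
  have hK1 : K ≤ 1 := Real.rpow_le_one_of_one_le_of_nonpos hq1.le (by linarith)
  have hKroot : K ^ (-1 / N) = q⁻¹ := by
    rw [hK, ← Real.rpow_mul (by linarith), mul_div_cancel₀ _ (by linarith), Real.rpow_neg_one]
  have hFmodel : ∀ x, F x = truncatedPowerCdf N θ K x := by
    intro x
    have hτ : 1 / c = (1 - q⁻¹) / θ := by
      have hc' : c = -θ * N := by rw [← hcN, div_mul_cancel₀ _ (by linarith)]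
      have : N ≠ 0 := by linarith
      have : N + 1 ≠ 0 := by linarith
      rw [hc', hq]
      field_simp
      ring
    rw [hF, truncatedPowerCdf, hKroot, hτ, hcN, neg_mul, ← sub_eq_add_neg]
  obtain ⟨hRint, hRval⟩ := integrable_cdf_sub_step_and_integral hW hWmass hxW
  simp_rw [← hRW] at hRint hRval
  rw [hWbar, neg_zero] at hRval
  obtain ⟨hHint, hHval⟩ := integrable_truncatedPowerCdf_sub_step_and_integral hN hθ hr0 hr1
  obtain ⟨hFint, hFval⟩ := integrable_truncatedPowerCdf_sub_step_and_integral hN hθ hK0 hK1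
  rw [hKroot, mul_inv_cancel₀ (by linarith), sub_self, zero_div] at hFval
  simp_rw [← hFmodel] at hFint hFval
  have hRH : ∀ x, R x ≤ truncatedPowerCdf N θ r x := by
    intro x
    unfold truncatedPowerCdf
    split_ifs with hx
    · rw [le_div_iff₀ hθ] at hx
      have : 0 < r ^ (-1 / N) := Real.rpow_pos_of_pos hr0 _
      rw [hRW]
      exact integral_Iic_indicator_le hN hw hconv h0 hW (hRW 0) hr0 hθdef (by linarith)
    · exact hRle x
  have hu : 1 ≤ q * r ^ (-1 / N) := by
    have h := integral_mono hRint hHint fun x => sub_le_sub_right (hRH x) _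
    rw [hRval, hHval] at h
    by_contra! hlt
    exact absurd h (not_le.2 (div_neg_of_neg_of_pos (by linarith) hθ))
  have hKr : K ≤ r := by
    by_contra! hlt
    have h1 : r ^ (-1 / N) < K ^ (-1 / N) :=
      Real.rpow_lt_rpow hr0.le hlt (div_pos_of_neg_of_neg (by linarith) (by linarith))
    rw [hKroot, lt_inv_comm₀ (Real.rpow_pos_of_pos hr0 _) (by linarith),
      lt_inv_comm₀ (by linarith) (Real.rpow_pos_of_pos hr0 _),
      ← one_div, lt_div_iff₀' (by linarith)] at h1
    linarith
  have hFH : ∀ x, F x ≤ truncatedPowerCdf N θ r x := fun x => by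
    rw [hFmodel]
    exact truncatedPowerCdf_mono hN hθ hK0 hKr x
  set step : ℝ → ℝ := (Set.Ioi (0 : ℝ)).indicator 1 with hstep
  set H := truncatedPowerCdf N θ r with hH
  have hbound : ∫ x, |R x - F x| ≤ 2 * ((q * r ^ (-1 / N) - 1) / θ) := by
    have h := integral_mono_of_nonneg (Filter.Eventually.of_forall fun x => abs_nonneg (R x - F x))
      ((hHint.sub hRint).add (hHint.sub hFint)) (Filter.Eventually.of_forall fun x => ?_)
    · refine h.trans_eq ?_
      rw [integral_add' (hHint.sub hRint) (hHint.sub hFint), integral_sub' hHint hRint,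
        integral_sub' hHint hFint, hHval, hRval, hFval]
      ring
    · simp only [Pi.add_apply, Pi.sub_apply]
      rw [abs_le]
      constructor <;> linarith [hRH x, hFH x]
  have hroot : q * r ^ (-1 / N) ≤ (1 + ε) ^ (-1 / N) := by
    have h1 := rpow_neg_one_div_mono hN hr0 hclose
    rw [Real.mul_rpow (by linarith) hK0.le, hKroot] at h1
    calc q * r ^ (-1 / N) ≤ q * ((1 + ε) ^ (-1 / N) * q⁻¹) :=
          mul_le_mul_of_nonneg_left h1 (by linarith)
      _ = (1 + ε) ^ (-1 / N) := by field_simp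
  calc ∫ x, |R x - F x| ≤ 2 * ((q * r ^ (-1 / N) - 1) / θ) := hbound
    _ = 2 * -N / w 0 * (r * (q * r ^ (-1 / N) - 1)) := by
        rw [hθdef]
        field_simp
    _ ≤ 2 * -N / w 0 * ((1 + ε) * K * ((1 + ε) ^ (-1 / N) - 1)) := by
        refine mul_le_mul_of_nonneg_left ?_ (div_nonneg (by linarith) hw0.le)
        exact mul_le_mul hclose (by linarith) (by linarith) (by positivity)
    _ = 2 * N / w 0 * K * (1 + ε) * (1 - (1 + ε) ^ (-1 / N)) := by ring
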